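/- Let a ∈ ℕA and let G be a face of A. Then a + ℕG cannot be written as a finite union ⋃_{i=1}^m (c_i + ℕF_i), where each c_i ∈ ℕA and each F_i is a face of A strictly contained in G. -/

import Mathlib

open scoped BigOperators

namespace StdPairsPaper

/-- The coercion of a lattice point to a real vector. -/
def toR {d : ℕ} (v : Fin d → ℤ) : Fin d → ℝ := fun i => (v i : ℝ)

/-- The cone of nonnegative real combinations of (the real images of) elements of `S`. -/
def cone {d : ℕ} (S : Set (Fin d → ℤ)) : Set (Fin d → ℝ) :=
  {x | ∃ (t : Finset (Fin d → ℤ)) (c : (Fin d → ℤ) → ℝ),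
    (t : Set (Fin d → ℤ)) ⊆ S ∧ (∀ v, 0 ≤ c v) ∧ x = ∑ v ∈ t, c v • toR v}

/-- `ℕS`, the submonoid of `ℤ^d` generated by `S`. -/
def NSemi {d : ℕ} (S : Set (Fin d → ℤ)) : AddSubmonoid (Fin d → ℤ) :=
  AddSubmonoid.closure S

/-- `ℤS`, the subgroup of `ℤ^d` generated by `S`. -/
def ZGrp {d : ℕ} (S : Set (Fin d → ℤ)) : AddSubgroup (Fin d → ℤ) :=
  AddSubgroup.closure S

/-- `ℝS`, the real linear span of `S`. -/
def RSpan {d : ℕ} (S : Set (Fin d → ℤ)) : Submodule ℝ (Fin d → ℝ) :=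
  Submodule.span ℝ (toR '' S)

/-- `A` is a configuration: a finite set of nonzero lattice points whose `ℤ`-span is `ℤ^d`
and whose nonnegative real cone is strongly convex (contains no line, i.e. is pointed). -/
structure IsConfig {d : ℕ} (A : Set (Fin d → ℤ)) : Prop where
  (finite : A.Finite)
  (nonzero : (0 : Fin d → ℤ) ∉ A)
  (spans : ZGrp A = ⊤)
  (pointed : ∀ x ∈ cone A, -x ∈ cone A → x = 0)

/-- `F` is a face of the configuration `A`: `F ⊆ A`, the cone over `F` is an extreme
subset (face) of the cone over `A`, and `ℝ_{≥0}F ∩ A = F`. -/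
def IsFace {d : ℕ} (A F : Set (Fin d → ℤ)) : Prop :=
  F ⊆ A ∧ IsExtreme ℝ (cone A) (cone F) ∧ cone F ∩ (toR '' A) = toR '' F

/-- The set `a + ℕF`. -/
def cell {d : ℕ} (a : Fin d → ℤ) (F : Set (Fin d → ℤ)) : Set (Fin d → ℤ) :=
  {x | ∃ f ∈ NSemi F, x = a + f}

/-- Two pairs `(a,F)` and `(b,F)` belonging to the same face `F` overlap: `a - b ∈ ℤF`. -/
def Overlap {d : ℕ} (F : Set (Fin d → ℤ)) (a b : Fin d → ℤ) : Prop :=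
  a - b ∈ ZGrp F

/-- The pair `(a,F)` divides the pair `(b,G)`:
there is `c ∈ ℕA` with `a + c + ℕF ⊆ b + ℕG`. -/
def PairDvd {d : ℕ} (A : Set (Fin d → ℤ)) (a : Fin d → ℤ) (F : Set (Fin d → ℤ))
    (b : Fin d → ℤ) (G : Set (Fin d → ℤ)) : Prop :=
  ∃ c ∈ NSemi A, cell (a + c) F ⊆ cell b G

/-- `E` is the exponent set of a monomial ideal of `ℕA`: `E ⊆ ℕA` and `E + ℕA ⊆ E`. -/
def IsExpSet {d : ℕ} (A E : Set (Fin d → ℤ)) : Prop :=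
  E ⊆ (NSemi A : Set (Fin d → ℤ)) ∧ ∀ e ∈ E, ∀ c ∈ NSemi A, e + c ∈ E

/-- The standard monomials of `E`: `ℕA ∖ E`. -/
def stdSet {d : ℕ} (A E : Set (Fin d → ℤ)) : Set (Fin d → ℤ) :=
  (NSemi A : Set (Fin d → ℤ)) \ E

/-- `(a,F)` is a proper pair of `E`: a pair of `A` with `a + ℕF ⊆ std(E)`. -/
def ProperPair {d : ℕ} (A E : Set (Fin d → ℤ)) (a : Fin d → ℤ)
    (F : Set (Fin d → ℤ)) : Prop :=
  a ∈ NSemi A ∧ IsFace A F ∧ cell a F ⊆ stdSet A E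

/-- `(a,F)` is a standard pair of `E`: a proper pair of `E` maximal with respect to
the partial order `(a,F) ≼ (b,G) ↔ a + ℕF ⊆ b + ℕG`. -/
def StdPair {d : ℕ} (A E : Set (Fin d → ℤ)) (a : Fin d → ℤ)
    (F : Set (Fin d → ℤ)) : Prop :=
  ProperPair A E a F ∧
    ∀ b G, ProperPair A E b G → cell a F ⊆ cell b G → cell b G ⊆ cell a F

/-- The overlap class of the standard pair `(a,F)` of `E` is maximal with respect to
divisibility among overlap classes of standard pairs of `E`. -/
def MaxClass {d : ℕ} (A E : Set (Fin d → ℤ)) (a : Fin d → ℤ)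
    (F : Set (Fin d → ℤ)) : Prop :=
  ∀ b G, StdPair A E b G → PairDvd A a F b G → PairDvd A b G a F

noncomputable section

/-- The affine semigroup ring `k[ℕA]`. -/
abbrev SGRing {d : ℕ} (k : Type*) [Field k] (A : Set (Fin d → ℤ)) :=
  AddMonoidAlgebra k (NSemi A)

/-- The monomial `t^a` of `k[ℕA]`. -/
def mono {d : ℕ} (k : Type*) [Field k] (A : Set (Fin d → ℤ)) (a : (NSemi A)) :
    SGRing k A :=
  AddMonoidAlgebra.single a 1

/-- `I` is a monomial ideal of `k[ℕA]`: an ideal generated by monomials. -/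
def IsMonomialIdeal {d : ℕ} (k : Type*) [Field k] (A : Set (Fin d → ℤ))
    (I : Ideal (SGRing k A)) : Prop :=
  ∃ S : Set (NSemi A), I = Ideal.span ((fun a => mono k A a) '' S)

/-- The exponent set `E(I) = {a ∈ ℕA : t^a ∈ I}` of an ideal of `k[ℕA]`,
as a subset of `ℤ^d`. -/
def expSet {d : ℕ} (k : Type*) [Field k] (A : Set (Fin d → ℤ))
    (I : Ideal (SGRing k A)) : Set (Fin d → ℤ) :=
  {x | ∃ h : x ∈ NSemi A, mono k A ⟨x, h⟩ ∈ I}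

/-- The monomial prime ideal `p_F = ⟨t^a : a ∈ ℕA ∖ ℕF⟩` of `k[ℕA]`. -/
def primeF {d : ℕ} (k : Type*) [Field k] (A F : Set (Fin d → ℤ)) :
    Ideal (SGRing k A) :=
  Ideal.span {x | ∃ a : (NSemi A), (a : Fin d → ℤ) ∉ NSemi F ∧ x = mono k A a}

end


theorem toR_injective {d : ℕ} : Function.Injective (toR : (Fin d → ℤ) → Fin d → ℝ) := by
  intro v w h
  funext i
  exact Int.cast_injective (α := ℝ) (congrFun h i)

theorem toR_add {d : ℕ} (v w : Fin d → ℤ) : toR (v + w) = toR v + toR w := by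
  funext i
  simp [toR]

theorem add_mem_cone {d : ℕ} {S : Set (Fin d → ℤ)} {x y : Fin d → ℝ}
    (hx : x ∈ cone S) (hy : y ∈ cone S) : x + y ∈ cone S := by
  classical
  obtain ⟨t, b, ht, hb, rfl⟩ := hx
  obtain ⟨u, c, hu, hc, rfl⟩ := hy
  refine ⟨t ∪ u, fun v => (if v ∈ t then b v else 0) + (if v ∈ u then c v else 0), ?_, ?_, ?_⟩
  · simp [ht, hu]
  · intro v
    have := hb v
    have := hc v
    dsimp only
    split_ifs <;> linarith
  · simp only [add_smul, ite_smul, zero_smul, Finset.sum_add_distrib, Finset.sum_ite_mem,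
      Finset.union_inter_cancel_left, Finset.union_inter_cancel_right]

theorem smul_mem_cone {d : ℕ} {S : Set (Fin d → ℤ)} {x : Fin d → ℝ} {r : ℝ}
    (hr : 0 ≤ r) (hx : x ∈ cone S) : r • x ∈ cone S := by
  obtain ⟨t, b, ht, hb, rfl⟩ := hx
  exact ⟨t, fun v => r * b v, ht, fun v => mul_nonneg hr (hb v), by
    simp only [Finset.smul_sum, mul_smul]⟩

theorem toR_mem_cone {d : ℕ} {S : Set (Fin d → ℤ)} {v : Fin d → ℤ} (hv : v ∈ NSemi S) :
    toR v ∈ cone S := by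
  induction hv using AddSubmonoid.closure_induction with
  | mem v hv => exact ⟨{v}, fun _ => 1, by simpa using hv, fun _ => zero_le_one, by simp⟩
  | zero => exact ⟨∅, fun _ => 0, by simp, fun _ => le_rfl, by funext i; simp [toR]⟩
  | add v w _ _ hv hw => exact toR_add v w ▸ add_mem_cone hv hw

/-- A face contains both summands of each of its points. -/
theorem mem_cone_of_add_mem_cone {d : ℕ} {S T : Set (Fin d → ℤ)}
    (h : IsExtreme ℝ (cone S) (cone T)) {x y : Fin d → ℝ}
    (hx : x ∈ cone S) (hy : y ∈ cone S) (hxy : x + y ∈ cone T) : x ∈ cone T := by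
  have h2 : (2 : ℝ) • x ∈ cone T := by
    refine h.left_mem_of_mem_openSegment (smul_mem_cone zero_le_two hx)
      (smul_mem_cone zero_le_two hy) hxy ⟨1 / 2, 1 / 2, by norm_num, by norm_num, by norm_num, ?_⟩
    simp [smul_smul]
  simpa [smul_smul] using smul_mem_cone (r := 1 / 2) (by norm_num) h2

/-- A generator that is a summand in `ℕA` of an element of `ℕF`, `F` a face, lies in `F`. -/
theorem mem_face_of_add_mem {d : ℕ} {A F : Set (Fin d → ℤ)} (hF : IsFace A F)
    {g h : Fin d → ℤ} (hg : g ∈ A) (hh : h ∈ NSemi A) (hgh : g + h ∈ NSemi F) : g ∈ F := by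
  have hcone : toR g ∈ cone F :=
    mem_cone_of_add_mem_cone hF.2.1 (toR_mem_cone (AddSubmonoid.subset_closure hg))
      (toR_mem_cone hh) (toR_add g h ▸ toR_mem_cone hgh)
  have : toR g ∈ toR '' F := hF.2.2 ▸ ⟨hcone, Set.mem_image_of_mem _ hg⟩
  exact toR_injective.mem_set_image.1 this

/-- For `a ∈ ℕA` and a face `G` of `A`, the set `a + ℕG` is not a
finite union of sets `c i + ℕ(F i)` with each `c i ∈ ℕA` and each `F i` a face of `A`
strictly contained in `G`. -/
theorem cell_not_finite_union_of_strictly_smaller_faces {d : ℕ}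
    (A : Set (Fin d → ℤ)) (hA : IsConfig A)
    (a : Fin d → ℤ) (ha : a ∈ NSemi A) (G : Set (Fin d → ℤ)) (hG : IsFace A G) :
    ¬ ∃ (m : ℕ) (c : Fin m → (Fin d → ℤ)) (Fc : Fin m → Set (Fin d → ℤ)),
      (∀ i, c i ∈ NSemi A ∧ IsFace A (Fc i) ∧ Fc i ⊆ G ∧ Fc i ≠ G) ∧
      cell a G = ⋃ i, cell (c i) (Fc i) := by
  classical
  rintro ⟨m, c, Fc, hF, hU⟩
  have hGfin : G.Finite := hA.finite.subset hG.1
  set s : Fin d → ℤ := ∑ v ∈ hGfin.toFinset, v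
  have hsG : s ∈ NSemi G := sum_mem fun v hv =>
    AddSubmonoid.subset_closure (hGfin.mem_toFinset.1 hv)
  have hGA : NSemi G ≤ NSemi A := AddSubmonoid.closure_mono hG.1
  have hcell : ∀ n : ℕ, ∃ i, a + n • s ∈ cell (c i) (Fc i) := fun n =>
    Set.mem_iUnion.1 (hU ▸ ⟨n • s, nsmul_mem hsG n, rfl⟩)
  choose i hi using hcell
  obtain ⟨n, k, hne, heq⟩ := Finite.exists_ne_map_eq_of_infinite i
  wlog hlt : n < k generalizing n k
  · exact this k n hne.symm heq.symm (by omega)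
  obtain ⟨f, hf, hnf⟩ := hi n
  obtain ⟨f', hf', hkf⟩ := hi k
  rw [← heq] at hf' hkf
  obtain ⟨-, hface, hsub, hneG⟩ := hF (i n)
  refine hneG (hsub.antisymm fun g hg => ?_)
  obtain ⟨l, rfl⟩ := Nat.exists_eq_add_of_lt hlt
  have hsum : g + ∑ v ∈ hGfin.toFinset.erase g, v = s :=
    Finset.add_sum_erase _ (fun v => v) (hGfin.mem_toFinset.2 hg)
  refine mem_face_of_add_mem hface (hG.1 hg)
    (h := ∑ v ∈ hGfin.toFinset.erase g, v + (l • s + f)) ?_ ?_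
  · refine hGA (add_mem (sum_mem fun v hv => AddSubmonoid.subset_closure
      (hGfin.mem_toFinset.1 (Finset.mem_of_mem_erase hv))) (add_mem (nsmul_mem hsG l) ?_))
    exact AddSubmonoid.closure_mono hsub hf
  · convert hf' using 1
    rw [← add_assoc, hsum]
    rw [add_nsmul, add_nsmul, one_nsmul] at hkf
    linear_combination hkf - hnf

end StdPairsPaper
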